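/- The radial mollified extension depends continuously on the boundary homeomorphism: if f_k : S¹ → S¹ (k ∈ ℕ) are homeomorphisms with f_k(1) = 1 converging uniformly to a homeomorphism f_∞ with f_∞(1) = 1, then F(f_k) converges uniformly to F(f_∞) on the closed unit disc. In fact, if sup_{z ∈ S¹} |f₁(z) - f₂(z)| < ε for two such homeomorphisms and their lifts satisfy sup_θ |g₁(θ) - g₂(θ)| < 2ε, then sup_{z ∈ 𝔻} |F(f₁)(z) - F(f₂)(z)| ≤ 2ε. -/

import Mathlib

open Metric MeasureTheory

noncomputable section

/-- The closed unit disc in `ℂ`. -/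
def unitDisc : Set ℂ := Metric.closedBall 0 1

/-- The unit circle in `ℂ`. -/
def unitCircle : Set ℂ := Metric.sphere 0 1

/-- The normalization constant `c = ∫_{-1}^{1} exp(-1/(1-x²)) dx`. -/
def bumpC : ℝ := ∫ x in (-1 : ℝ)..1, Real.exp (-1 / (1 - x ^ 2))

/-- The normalized smooth bump `β_ε` supported on `[-ε, ε]`. -/
def bump (ε x : ℝ) : ℝ :=
  if |x| < ε then (1 / (bumpC * ε)) * Real.exp (-1 / (1 - (x / ε) ^ 2)) else 0

/-- The convolution `(β_ε * g)(θ) = ∫ β_ε(x) g(θ - x) dx`. -/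
def bumpConv (ε : ℝ) (g : ℝ → ℝ) (θ : ℝ) : ℝ := ∫ x : ℝ, bump ε x * g (θ - x)

/-- `f` restricts to a homeomorphism of the unit circle (a continuous bijection of the compact
circle onto itself). -/
def CircleHomeo (f : ℂ → ℂ) : Prop :=
  ContinuousOn f unitCircle ∧ Set.BijOn f unitCircle unitCircle

/-- `g` is the continuous lift of `f` with `f (e^{iθ}) = e^{i g θ}` and `g 0 = 0`. -/
def IsLift (f : ℂ → ℂ) (g : ℝ → ℝ) : Prop :=
  Continuous g ∧ g 0 = 0 ∧
    ∀ θ : ℝ, f (Complex.exp (θ * Complex.I)) = Complex.exp (g θ * Complex.I)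

/-- The radial mollified extension `F(f)` of a circle homeomorphism `f` with lift `g`:
`F(0) = 0`, `F(r e^{iθ}) = r e^{i (β_{1-r} * g)(θ)}` for `0 < r < 1`, and `F = f` on the
circle. -/
def radExt (f : ℂ → ℂ) (g : ℝ → ℝ) (z : ℂ) : ℂ :=
  if ‖z‖ = 1 then f z
  else (‖z‖ : ℂ) *
    Complex.exp ((bumpConv (1 - ‖z‖) g (Complex.arg z) : ℝ) * Complex.I)

lemma bumpC_nonneg : 0 ≤ bumpC :=
  intervalIntegral.integral_nonneg (by norm_num) fun _ _ => (Real.exp_pos _).le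

lemma bump_nonneg {ε : ℝ} (hε : 0 < ε) (x : ℝ) : 0 ≤ bump ε x := by
  have := bumpC_nonneg
  unfold bump
  split_ifs <;> positivity

lemma bump_le {ε : ℝ} (hε : 0 < ε) (x : ℝ) : bump ε x ≤ 1 / (bumpC * ε) := by
  have := bumpC_nonneg
  unfold bump
  split_ifs with h
  · refine mul_le_of_le_one_right (by positivity) (Real.exp_le_one_iff.2 ?_)
    have hx : (x / ε) ^ 2 < 1 := by
      rw [sq_lt_one_iff_abs_lt_one, abs_div, abs_of_pos hε, div_lt_one hε]
      exact h
    exact div_nonpos_of_nonpos_of_nonneg (by norm_num) (by linarith)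
  · positivity

lemma measurable_bump (ε : ℝ) : Measurable (bump ε) := by
  unfold bump
  exact Measurable.ite (measurableSet_lt (by fun_prop) (by fun_prop)) (by fun_prop) (by fun_prop)

lemma bump_eq_indicator (ε : ℝ) :
    bump ε = (Set.Ioo (-ε) ε).indicator
      fun x => (1 / (bumpC * ε)) * Real.exp (-1 / (1 - (x / ε) ^ 2)) := by
  ext x
  simp [bump, Set.indicator, abs_lt]

lemma integrable_bump_mul {ε : ℝ} (hε : 0 < ε) {g : ℝ → ℝ} (hg : Continuous g) :
    Integrable fun x => bump ε x * g x := by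
  have hon : IntegrableOn (fun x => bump ε x * g x) (Set.Icc (-ε) ε) := by
    refine Integrable.bdd_mul (c := 1 / (bumpC * ε)) hg.integrableOn_Icc
      (measurable_bump ε).aestronglyMeasurable (Filter.Eventually.of_forall fun x => ?_)
    rw [Real.norm_of_nonneg (bump_nonneg hε x)]
    exact bump_le hε x
  refine (integrableOn_iff_integrable_of_support_subset fun x hx => ?_).1 hon
  by_contra hx'
  refine hx ?_
  have : ¬ |x| < ε := fun h => hx' ⟨(abs_lt.1 h).1.le, (abs_lt.1 h).2.le⟩
  simp [bump, this]

lemma integral_bump_le_one {ε : ℝ} (hε : 0 < ε) : ∫ x, bump ε x ≤ 1 := by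
  rw [bump_eq_indicator, integral_indicator measurableSet_Ioo, ← integral_Ioc_eq_integral_Ioo,
    ← intervalIntegral.integral_of_le (by linarith), intervalIntegral.integral_const_mul,
    intervalIntegral.integral_comp_div (fun x => Real.exp (-1 / (1 - x ^ 2))) hε.ne',
    neg_div, div_self hε.ne']
  change 1 / (bumpC * ε) * (ε * bumpC) ≤ 1
  rw [mul_comm ε, one_div]
  exact inv_mul_le_one

lemma abs_bumpConv_sub_le {ε δ : ℝ} (hε : 0 < ε) (hδ : 0 ≤ δ) {g₁ g₂ : ℝ → ℝ}
    (hg₁ : Continuous g₁) (hg₂ : Continuous g₂) (h : ∀ θ, |g₁ θ - g₂ θ| ≤ δ) (θ : ℝ) :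
    |bumpConv ε g₁ θ - bumpConv ε g₂ θ| ≤ δ := by
  have hi : Integrable (bump ε) := by
    simpa using integrable_bump_mul hε (continuous_const (y := (1 : ℝ)))
  unfold bumpConv
  rw [← integral_sub (integrable_bump_mul hε (by fun_prop))
    (integrable_bump_mul hε (by fun_prop)), ← Real.norm_eq_abs]
  calc _ ≤ ∫ x, bump ε x * δ := by
        refine norm_integral_le_of_norm_le (hi.mul_const δ) (Filter.Eventually.of_forall fun x => ?_)
        rw [← mul_sub, norm_mul, Real.norm_of_nonneg (bump_nonneg hε x)]
        exact mul_le_mul_of_nonneg_left (h _) (bump_nonneg hε x)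
    _ = (∫ x, bump ε x) * δ := integral_mul_const _ _
    _ ≤ δ := mul_le_of_le_one_left hδ (integral_bump_le_one hε)

lemma dist_exp_ofReal_mul_I (a b : ℝ) :
    dist (Complex.exp (a * Complex.I)) (Complex.exp (b * Complex.I)) =
      2 * |Real.sin ((a - b) / 2)| := by
  have h : Complex.exp (a * Complex.I) - Complex.exp (b * Complex.I) =
      Complex.exp (b * Complex.I) * (Complex.exp (Complex.I * (a - b : ℝ)) - 1) := by
    rw [mul_sub, ← Complex.exp_add, mul_one]
    push_cast
    ring_nf
  rw [dist_eq_norm, h, norm_mul, Complex.norm_exp_ofReal_mul_I, one_mul,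
    Complex.norm_exp_I_mul_ofReal_sub_one]
  simp

lemma dist_exp_ofReal_mul_I_le (a b : ℝ) :
    dist (Complex.exp (a * Complex.I)) (Complex.exp (b * Complex.I)) ≤ |a - b| := by
  rw [dist_exp_ofReal_mul_I]
  have := Real.abs_sin_le_abs (x := (a - b) / 2)
  rw [abs_div, abs_two] at this
  linarith

lemma exp_ofReal_mul_I_mem_unitCircle (θ : ℝ) :
    Complex.exp (θ * Complex.I) ∈ unitCircle := by
  simp [unitCircle, Complex.norm_exp_ofReal_mul_I]

/-- Lifts of circle maps at distance less than `δ < 2` are at distance less than `2δ`: their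
difference vanishes at `0` and cannot reach `±π`. -/
lemma IsLift.abs_sub_lt {f₁ f₂ : ℂ → ℂ} {g₁ g₂ : ℝ → ℝ} {δ : ℝ}
    (h₁ : IsLift f₁ g₁) (h₂ : IsLift f₂ g₂) (hδ : δ < 2)
    (h : ∀ z ∈ unitCircle, dist (f₁ z) (f₂ z) < δ) (θ : ℝ) : |g₁ θ - g₂ θ| < 2 * δ := by
  obtain ⟨hc₁, hz₁, he₁⟩ := h₁
  obtain ⟨hc₂, hz₂, he₂⟩ := h₂
  have hsin (t : ℝ) : 2 * |Real.sin ((g₁ t - g₂ t) / 2)| < δ := by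
    rw [← dist_exp_ofReal_mul_I, ← he₁, ← he₂]
    exact h _ (exp_ofReal_mul_I_mem_unitCircle t)
  have hlt : |g₁ θ - g₂ θ| < Real.pi := by
    by_contra! hge
    have hcont : Continuous fun t => |g₁ t - g₂ t| := by fun_prop
    obtain ⟨t, ht⟩ := mem_range_of_exists_le_of_exists_ge hcont
      ⟨0, by simpa [hz₁, hz₂] using Real.pi_pos.le⟩ ⟨θ, hge⟩
    have hs := hsin t
    rcases (abs_eq Real.pi_pos.le).1 ht with ht | ht <;>
      norm_num [ht, neg_div] at hs <;> linarith
  have hjordan := Real.mul_abs_le_abs_sin (x := (g₁ θ - g₂ θ) / 2) (by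
    rw [abs_div, abs_two]; linarith)
  rw [abs_div, abs_two] at hjordan
  have hs := hsin θ
  have hle : 2 / Real.pi * |g₁ θ - g₂ θ| < δ := by linarith
  rw [div_mul_eq_mul_div, div_lt_iff₀ Real.pi_pos] at hle
  have hδ₀ : 0 < δ := lt_of_le_of_lt (by positivity) hs
  nlinarith [Real.pi_lt_four]

lemma dist_radExt_le {f₁ f₂ : ℂ → ℂ} {g₁ g₂ : ℝ → ℝ} {δ : ℝ} (hδ : 0 ≤ δ)
    (hg₁ : Continuous g₁) (hg₂ : Continuous g₂)
    (hf : ∀ z ∈ unitCircle, dist (f₁ z) (f₂ z) ≤ δ) (hg : ∀ θ, |g₁ θ - g₂ θ| ≤ δ)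
    {z : ℂ} (hz : z ∈ unitDisc) : dist (radExt f₁ g₁ z) (radExt f₂ g₂ z) ≤ δ := by
  have hz1 : ‖z‖ ≤ 1 := by simpa [unitDisc] using hz
  unfold radExt
  split_ifs with h
  · exact hf z (by simpa [unitCircle] using h)
  · have hr : 0 < 1 - ‖z‖ := sub_pos.2 (lt_of_le_of_ne hz1 h)
    rw [dist_eq_norm, ← mul_sub, norm_mul, Complex.norm_real, norm_norm, ← dist_eq_norm]
    exact (mul_le_of_le_one_left dist_nonneg hz1).trans
      ((dist_exp_ofReal_mul_I_le _ _).trans (abs_bumpConv_sub_le hr hδ hg₁ hg₂ hg _))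

open Filter in
/-- The radial mollified extension depends continuously on the boundary homeomorphism:
if circle homeomorphisms fixing `1` converge uniformly on the circle, then their radial
mollified extensions converge uniformly on the closed disc; quantitatively, if two such
homeomorphisms are within `ε` on the circle and their lifts are within `2ε`, then the
extensions are within `2ε` on the closed disc. -/
theorem radExt_continuous_dependence :
    (∀ (f : ℕ → ℂ → ℂ) (flim : ℂ → ℂ) (g : ℕ → ℝ → ℝ) (glim : ℝ → ℝ),
      (∀ k, CircleHomeo (f k)) → (∀ k, f k 1 = 1) → (∀ k, IsLift (f k) (g k)) →
      CircleHomeo flim → flim 1 = 1 → IsLift flim glim →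
      TendstoUniformlyOn f flim atTop unitCircle →
      TendstoUniformlyOn (fun k => radExt (f k) (g k)) (radExt flim glim) atTop unitDisc) ∧
    (∀ (f₁ f₂ : ℂ → ℂ) (g₁ g₂ : ℝ → ℝ) (ε : ℝ), 0 < ε →
      CircleHomeo f₁ → f₁ 1 = 1 → IsLift f₁ g₁ →
      CircleHomeo f₂ → f₂ 1 = 1 → IsLift f₂ g₂ →
      (∀ z ∈ unitCircle, dist (f₁ z) (f₂ z) < ε) →
      (∀ θ : ℝ, |g₁ θ - g₂ θ| < 2 * ε) →
      ∀ z ∈ unitDisc, dist (radExt f₁ g₁ z) (radExt f₂ g₂ z) ≤ 2 * ε) := by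
  refine ⟨fun f flim g glim _ _ hg _ _ hglim hf => ?_, ?_⟩
  · rw [Metric.tendstoUniformlyOn_iff] at hf ⊢
    intro ε hε
    have hδ : 0 < min 1 (ε / 4) := by positivity
    filter_upwards [hf _ hδ] with k hk z hz
    have hlift := hglim.abs_sub_lt (hg k) ((min_le_left _ _).trans_lt one_lt_two) hk
    have hle := dist_radExt_le (by positivity) hglim.1 (hg k).1
      (fun w hw => (hk w hw).le.trans (by linarith)) (fun θ => (hlift θ).le) hz
    have := min_le_right 1 (ε / 4)
    linarith
  · intro f₁ f₂ g₁ g₂ ε hε _ _ h₁ _ _ h₂ hf hg z hz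
    exact dist_radExt_le (by positivity) h₁.1 h₂.1
      (fun w hw => (hf w hw).le.trans (by linarith)) (fun θ => (hg θ).le) hz
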